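/- arXiv:2402.00545 — 2 statements merged into one kernel-verified Lean document; each statement's English description precedes it below -/
import Mathlib

section
/- Let g be a derived distribution on 𝔜 with values in an abelian group M (written additively), let Y ⊆ Y' be A-lattices in V, and let 𝔭 be a maximal ideal of A whose residue field A/𝔭 has q^d elements and such that the 𝔭-torsion of Y'/Y is trivial. Fix i with 0 < i < r, let c := #ℒ(Y,𝔭,i) (the number of i-dimensional subspaces of (A/𝔭)^r), and for Z ∈ ℒ(Y,𝔭,i) put Z' := Z + 𝔭Y'. Then m := c·(q^{di} − 1)/(q^{dr} − 1) is an integer, and ∑_{Z ∈ ℒ(Y,𝔭,i)} Disc(g)^{Z'|Z} = (c − m)·(Disc(g)^{𝔭Y'|𝔭Y} − Disc(g)^{Y'|Y}) + c·Disc(g)^{Y'|Y}; here the integer e := c − m equals c·q^{di}·(q^{d(r−i)} − 1)/(q^{dr} − 1). -/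
open scoped Classical

noncomputable section

variable {A : Type*} [CommRing A] [IsDomain A] [IsDedekindDomain A]
variable {K : Type*} [Field K] [Algebra A K] [IsFractionRing A K]
variable {r : ℕ}

/-- An `A`-lattice in `V = K^r`: a finitely generated `A`-submodule spanning `V` over `K`. -/
def IsLattice (Y : Submodule A (Fin r → K)) : Prop :=
  Y.FG ∧ Submodule.span K (Y : Set (Fin r → K)) = ⊤

/-- `R` is a complete set of representatives for the classes of `Y'` modulo `Y`. -/
def IsRepSet (Y Y' : Submodule A (Fin r → K)) (R : Finset (Fin r → K)) : Prop :=
  (∀ w ∈ R, w ∈ Y') ∧ ∀ y ∈ Y', ∃! w, w ∈ R ∧ y - w ∈ Y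

/-- `Disc(g)^{Y'|Y} = -∑_{0 ≠ u ∈ Y'/Y} g(u, Y)`, computed via a choice of a complete
set of representatives of `Y'/Y` containing `0`. -/
def disc {M : Type*} [AddCommGroup M]
    (g : (Fin r → K) → Submodule A (Fin r → K) → M)
    (Y Y' : Submodule A (Fin r → K)) : M :=
  if h : ∃ R : Finset (Fin r → K), IsRepSet Y Y' R ∧ (0 : Fin r → K) ∈ R then
    - ∑ w ∈ h.choose.erase 0, g w Y
  else 0

/-- A derived distribution on `𝔜` with values in `M`: `g` vanishes on pairs with `u ∈ Y`,
depends only on the class of `u` modulo `Y`, and satisfies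
`∑_u g(u,Y) + Disc(g)^{Y'|Y} = g(v,Y')` for every lattice pair `Y ⊆ Y'` and `v ∉ Y'`,
the sum over the classes `u` mod `Y` contained in `v + Y'`. -/
def IsDerivedDistribution {M : Type*} [AddCommGroup M]
    (g : (Fin r → K) → Submodule A (Fin r → K) → M) : Prop :=
  (∀ u Y, IsLattice Y → u ∈ Y → g u Y = 0) ∧
  (∀ u u' Y, IsLattice Y → u - u' ∈ Y → g u Y = g u' Y) ∧
  (∀ Y Y' : Submodule A (Fin r → K), IsLattice Y → IsLattice Y' → Y ≤ Y' →
    ∀ R : Finset (Fin r → K), IsRepSet Y Y' R →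
      ∀ v : Fin r → K, v ∉ Y' → (∑ w ∈ R, g (v + w) Y) + disc g Y Y' = g v Y')

/-- `ℒ(Y, 𝔭, i)`: the `A`-submodules `Z` with `𝔭Y ⊆ Z ⊆ Y` and `dim_{A/𝔭} (Z/𝔭Y) = i`
(expressed via the cardinality `#(A/𝔭)^i`). -/
def lset (𝔭 : Ideal A) (Y : Submodule A (Fin r → K)) (i : ℕ) :
    Set (Submodule A (Fin r → K)) :=
  {Z | 𝔭 • Y ≤ Z ∧ Z ≤ Y ∧
    Nat.card (Z ⧸ Submodule.comap Z.subtype (𝔭 • Y)) = Nat.card (A ⧸ 𝔭) ^ i}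

section RepresentativeSets


variable {Y Y' Z Z' : Submodule A (Fin r → K)}

theorem IsRepSet.card_eq {R : Finset (Fin r → K)} (h : IsRepSet Y Y' R) :
    R.card = Nat.card (Y' ⧸ Submodule.comap Y'.subtype Y) := by
  have hcard : Nat.card (R : Set (Fin r → K)) = R.card := by simp
  rw [← hcard]
  refine Nat.card_eq_of_bijective
    (fun w : (R : Set (Fin r → K)) =>
      (Submodule.Quotient.mk ⟨w.1, h.1 w.1 w.2⟩ : Y' ⧸ Submodule.comap Y'.subtype Y)) ⟨?_, ?_⟩
  · rintro ⟨a, ha⟩ ⟨b, hb⟩ hab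
    rw [Submodule.Quotient.eq] at hab
    exact Subtype.ext ((h.2 a (h.1 a ha)).unique ⟨ha, by simp⟩ ⟨hb, by simpa using hab⟩)
  · intro x
    induction x using Submodule.Quotient.induction_on with
    | H y =>
      obtain ⟨w, ⟨hw, hyw⟩, -⟩ := h.2 y.1 y.2
      refine ⟨⟨w, hw⟩, ((Submodule.Quotient.eq _).2 ?_).symm⟩
      simpa using hyw

theorem exists_isRepSet [Finite (Y' ⧸ Submodule.comap Y'.subtype Y)] :
    ∃ R : Finset (Fin r → K), IsRepSet Y Y' R ∧ (0 : Fin r → K) ∈ R := by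
  have := Fintype.ofFinite (Y' ⧸ Submodule.comap Y'.subtype Y)
  let f : (Y' ⧸ Submodule.comap Y'.subtype Y) → Y' := fun x => if x = 0 then 0 else x.out
  have hf : ∀ x, Submodule.Quotient.mk (f x) = x := by
    intro x
    by_cases hx : x = 0
    · simp [f, hx]
    · simp [f, hx]
  refine ⟨Finset.univ.image fun x => (f x : Fin r → K), ⟨?_, ?_⟩, ?_⟩
  · simp
  · intro y hy
    refine ⟨f (Submodule.Quotient.mk ⟨y, hy⟩), ⟨by simp, ?_⟩, ?_⟩
    · have := (Submodule.Quotient.eq _).1 (hf (Submodule.Quotient.mk ⟨y, hy⟩)).symm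
      simpa using this
    · rintro w ⟨hw, hyw⟩
      obtain ⟨x, -, rfl⟩ := Finset.mem_image.1 hw
      have : (Submodule.Quotient.mk ⟨y, hy⟩ : Y' ⧸ Submodule.comap Y'.subtype Y) =
          Submodule.Quotient.mk (f x) := (Submodule.Quotient.eq _).2 (by simpa using hyw)
      rw [this, hf]
  · exact Finset.mem_image.2 ⟨0, by simp, by simp [f]⟩

theorem IsRepSet.sum_eq {M : Type*} [AddCommMonoid M] {R R' : Finset (Fin r → K)}
    (h : IsRepSet Y Y' R) (h' : IsRepSet Y Y' R') {f : (Fin r → K) → M}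
    (hf : ∀ u u', u - u' ∈ Y → f u = f u') : ∑ w ∈ R, f w = ∑ w ∈ R', f w := by
  choose! e he using fun w (hw : w ∈ R) => (h'.2 w (h.1 w hw)).exists
  refine Finset.sum_bij (fun w _ => e w) (fun w hw => (he w hw).1) ?_ ?_
    (fun w hw => hf _ _ (he w hw).2)
  · intro a ha b hb hab
    refine (h.2 a (h.1 a ha)).unique ⟨ha, by simp⟩ ⟨hb, ?_⟩
    have := Y.sub_mem (he a ha).2 (he b hb).2
    rw [hab] at this
    simpa using this
  · intro b hb
    obtain ⟨a, ⟨ha, hba⟩, -⟩ := h.2 b (h'.1 b hb)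
    refine ⟨a, ha, ?_⟩
    refine (h'.2 b (h'.1 b hb)).unique ⟨(he a ha).1, ?_⟩ ⟨hb, by simp⟩
    simpa using Y.add_mem hba (he a ha).2

theorem IsRepSet.mono {R : Finset (Fin r → K)} (h : IsRepSet Y Y' R) (hY : Y' ≤ Z')
    (hsup : Z' ≤ Z ⊔ Y') (hZ : Y ≤ Z) (hinf : Y' ⊓ Z ≤ Y) : IsRepSet Z Z' R := by
  refine ⟨fun w hw => hY (h.1 w hw), fun y hy => ?_⟩
  obtain ⟨z, hz, y', hy', rfl⟩ := Submodule.mem_sup.1 (hsup hy)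
  obtain ⟨w, ⟨hw, hyw⟩, huniq⟩ := h.2 y' hy'
  refine ⟨w, ⟨hw, ?_⟩, ?_⟩
  · rw [add_sub_assoc]
    exact Z.add_mem hz (hZ hyw)
  · rintro w' ⟨hw', hyw'⟩
    refine huniq w' ⟨hw', hinf ⟨Y'.sub_mem hy' (h.1 w' hw'), ?_⟩⟩
    have := Z.sub_mem hyw' hz
    rwa [add_sub_assoc, add_sub_cancel_left] at this

theorem IsRepSet.filter_mem {R : Finset (Fin r → K)} (h : IsRepSet Y Y' R) (hZ : Y ≤ Z)
    (hZ' : Z ≤ Y') : IsRepSet Y Z (R.filter (· ∈ Z)) := by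
  refine ⟨fun w hw => (Finset.mem_filter.1 hw).2, fun y hy => ?_⟩
  obtain ⟨w, ⟨hw, hyw⟩, huniq⟩ := h.2 y (hZ' hy)
  refine ⟨w, ⟨Finset.mem_filter.2 ⟨hw, ?_⟩, hyw⟩, ?_⟩
  · simpa using Z.sub_mem hy (hZ hyw)
  · rintro w' ⟨hw', hyw'⟩
    exact huniq w' ⟨(Finset.mem_filter.1 hw').1, hyw'⟩

theorem IsRepSet.eq_zero_of_mem {R : Finset (Fin r → K)} (h : IsRepSet Y Y' R)
    (h0 : (0 : Fin r → K) ∈ R) {w : Fin r → K} (hw : w ∈ R) (hwY : w ∈ Y) : w = 0 :=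
  (h.2 w (h.1 w hw)).unique ⟨hw, by simp⟩ ⟨h0, by simpa using hwY⟩

variable {M : Type*} [AddCommGroup M] {g : (Fin r → K) → Submodule A (Fin r → K) → M}

theorem IsDerivedDistribution.disc_eq (hg : IsDerivedDistribution g) (hY : IsLattice Y)
    {R : Finset (Fin r → K)} (hR : IsRepSet Y Y' R) (h0 : (0 : Fin r → K) ∈ R) :
    disc g Y Y' = -∑ w ∈ R, g w Y := by
  have h : ∃ R : Finset (Fin r → K), IsRepSet Y Y' R ∧ (0 : Fin r → K) ∈ R := ⟨R, hR, h0⟩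
  rw [disc, dif_pos h, Finset.sum_erase (f := fun w => g w Y) _ (hg.1 0 Y hY Y.zero_mem),
    h.choose_spec.1.sum_eq hR fun u u' => hg.2.1 u u' Y hY]

theorem disc_self : disc g Y Y = 0 := by
  have h : ∃ R : Finset (Fin r → K), IsRepSet Y Y R ∧ (0 : Fin r → K) ∈ R := by
    refine ⟨{0}, ⟨by simp, fun y hy => ⟨0, by simpa using hy, by simp⟩⟩, by simp⟩
  rw [disc, dif_pos h, neg_eq_zero]
  refine Finset.sum_eq_zero fun w hw => ?_
  obtain ⟨hw0, hw⟩ := Finset.mem_erase.1 hw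
  exact (hw0 (h.choose_spec.1.eq_zero_of_mem h.choose_spec.2 hw (h.choose_spec.1.1 w hw))).elim

theorem IsDerivedDistribution.apply_eq_sum (hg : IsDerivedDistribution g) (hY : IsLattice Y)
    (hY' : IsLattice Y') (hle : Y ≤ Y') {R : Finset (Fin r → K)} (hR : IsRepSet Y Y' R)
    (h0 : (0 : Fin r → K) ∈ R) {v : Fin r → K} (hv : v ∉ Y') :
    g v Y' = ∑ w ∈ R, (g (v + w) Y - g w Y) := by
  rw [← hg.2.2 Y Y' hY hY' hle R hR v hv, hg.disc_eq hY hR h0, Finset.sum_sub_distrib,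
    sub_eq_add_neg]

end RepresentativeSets

section Lattices

variable {Y Y' Z : Submodule A (Fin r → K)} {𝔭 : Ideal A}

theorem IsLattice.of_smul_le (hY : IsLattice Y) (hZ : Z ≤ Y) {a : A} (ha : a ≠ 0)
    (haZ : ∀ y ∈ Y, a • y ∈ Z) : IsLattice Z := by
  have : Module.Finite A Y := Module.Finite.iff_fg.2 hY.1
  refine ⟨?_, ?_⟩
  · have := (IsNoetherian.noetherian (Z.comap Y.subtype)).map Y.subtype
    rwa [Submodule.map_comap_subtype, inf_eq_right.2 hZ] at this
  · rw [eq_top_iff, ← hY.2, Submodule.span_le]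
    intro y hy
    have ha' : algebraMap A K a ≠ 0 := by simpa using ha
    have h := Submodule.smul_mem _ (algebraMap A K a)⁻¹
      (Submodule.subset_span (R := K) (haZ y hy))
    rwa [← algebraMap_smul K a y, smul_smul, inv_mul_cancel₀ ha', one_smul] at h

theorem exists_ne_zero_smul_mem (hY : Submodule.span K (Y : Set (Fin r → K)) = ⊤)
    (hY' : Y'.FG) : ∃ a : A, a ≠ 0 ∧ ∀ y ∈ Y', a • y ∈ Y := by
  have key : ∀ v : Fin r → K, ∃ a : A, a ≠ 0 ∧ a • v ∈ Y := by
    intro v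
    have hv : v ∈ Submodule.span K (Y : Set (Fin r → K)) := hY ▸ Submodule.mem_top
    induction hv using Submodule.span_induction with
    | mem x hx => exact ⟨1, one_ne_zero, by simpa using hx⟩
    | zero => exact ⟨1, one_ne_zero, by simp⟩
    | add x y _ _ hx hy =>
      obtain ⟨a, ha, hax⟩ := hx
      obtain ⟨b, hb, hby⟩ := hy
      refine ⟨a * b, mul_ne_zero ha hb, ?_⟩
      rw [smul_add]
      refine Y.add_mem ?_ ?_
      · rw [mul_comm, mul_smul]
        exact Y.smul_mem b hax
      · rw [mul_smul]
        exact Y.smul_mem a hby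
    | smul c x _ hx =>
      obtain ⟨a, ha, hax⟩ := hx
      obtain ⟨n, d, hd, rfl⟩ := IsFractionRing.div_surjective (A := A) c
      have hd0 := nonZeroDivisors.ne_zero hd
      have hd' : algebraMap A K d ≠ 0 := by simpa using hd0
      refine ⟨a * d, mul_ne_zero ha hd0, ?_⟩
      have : (a * d) • (algebraMap A K n / algebraMap A K d) • x = n • a • x := by
        rw [← algebraMap_smul K (a * d), ← algebraMap_smul K n, ← algebraMap_smul K a x,
          smul_smul, smul_smul, map_mul]
        congr 1
        field_simp
      rw [this]
      exact Y.smul_mem n hax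
  obtain ⟨s, rfl⟩ := hY'
  choose f hf0 hf using key
  refine ⟨∏ x ∈ s, f x, Finset.prod_ne_zero_iff.2 fun x _ => hf0 x, fun y hy => ?_⟩
  induction hy using Submodule.span_induction with
  | mem x hx =>
    rw [← Finset.prod_erase_mul s f hx, mul_smul]
    exact Y.smul_mem _ (hf x)
  | zero => simp
  | add x y _ _ hx hy => rw [smul_add]; exact Y.add_mem hx hy
  | smul c x _ hx => rw [smul_comm]; exact Y.smul_mem c hx

theorem exists_smul_mem_of_torsion_eq_bot
    (hY : Submodule.span K (Y : Set (Fin r → K)) = ⊤) (hY' : Y'.FG) (h𝔭 : 𝔭.IsMaximal)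
    (htor : ∀ y ∈ Y', (∀ a ∈ 𝔭, a • y ∈ Y) → y ∈ Y) :
    ∃ t : A, (∀ y ∈ Y', t • y ∈ Y) ∧ 1 - t ∈ 𝔭 := by
  let I : Ideal A := Y.colon (Y' : Set (Fin r → K))
  have hI : ∀ {t}, t ∈ I ↔ ∀ y ∈ Y', t • y ∈ Y := Submodule.mem_colon
  have hI0 : I ≠ ⊥ := by
    obtain ⟨a, ha, haY⟩ := exists_ne_zero_smul_mem hY hY'
    exact fun h => ha (by simpa [h] using hI.2 haY)
  have hIp : ¬ I ≤ 𝔭 := by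
    intro hle
    obtain ⟨J, hJ⟩ := Ideal.dvd_iff_le.2 hle
    have hJI : J ≤ I := fun b hb => hI.2 fun y hy => htor _ (Y'.smul_mem b hy) fun a ha => by
      rw [smul_smul]
      exact hI.1 (hJ ▸ Ideal.mul_mem_mul ha hb) y hy
    have hIJ : I = J := le_antisymm (hJ ▸ Ideal.mul_le_right) hJI
    rw [← hIJ] at hJ
    refine h𝔭.ne_top ?_
    rw [← Ideal.one_eq_top]
    exact mul_right_cancel₀ hI0 (by rw [← hJ, one_mul])
  have hsup : 𝔭 ⊔ I = ⊤ := h𝔭.1.2 _ (left_lt_sup.2 hIp)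
  obtain ⟨a, ha, t, ht, hat⟩ := Submodule.mem_sup.1 ((Ideal.eq_top_iff_one _).1 hsup)
  exact ⟨t, hI.1 ht, by rwa [← hat, add_sub_cancel_right]⟩

theorem le_sup_smul_and_inf_smul_le {t : A} (ht : ∀ y ∈ Y', t • y ∈ Y)
    (ht1 : 1 - t ∈ 𝔭) : Y' ≤ Y ⊔ 𝔭 • Y' ∧ 𝔭 • Y' ⊓ Y ≤ 𝔭 • Y := by
  have hdec : ∀ y : Fin r → K, y = t • y + (1 - t) • y := fun y => by
    rw [← add_smul, add_sub_cancel, one_smul]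
  refine ⟨fun y hy => ?_, fun y hy => ?_⟩
  · rw [hdec y]
    exact Submodule.add_mem_sup (ht y hy) (Submodule.smul_mem_smul ht1 hy)
  · rw [hdec y]
    refine Submodule.add_mem _ ?_ (Submodule.smul_mem_smul ht1 hy.2)
    refine Submodule.smul_induction_on hy.1 (fun a ha n hn => ?_) fun x y hx hy => ?_
    · rw [smul_comm]
      exact Submodule.smul_mem_smul ha (ht n hn)
    · rw [smul_add]
      exact Submodule.add_mem _ hx hy

theorem comap_subtype_smul : (𝔭 • Y).comap Y.subtype = 𝔭 • (⊤ : Submodule A Y) := by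
  rw [← Submodule.comap_map_eq_of_injective Y.subtype_injective (𝔭 • ⊤),
    Submodule.map_smul'', Submodule.map_top, Submodule.range_subtype]

theorem IsLattice.finrank_quotient (hY : IsLattice Y) (h𝔭 : 𝔭.IsMaximal) :
    Module.finrank (A ⧸ 𝔭) (Y ⧸ 𝔭 • (⊤ : Submodule A Y)) = r := by
  let _ := Ideal.Quotient.field 𝔭
  have : Module.Finite A Y := Module.Finite.iff_fg.2 hY.1
  let b := Module.finBasis (A ⧸ 𝔭) (Y ⧸ 𝔭 • (⊤ : Submodule A Y))
  choose y hy using fun j => Submodule.Quotient.mk_surjective _ (b j)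
  let P : Submodule A Y := Submodule.span A (Set.range y)
  have hP : ⊤ ≤ P ⊔ 𝔭 • (⊤ : Submodule A Y) := by
    intro x _
    choose c hc using fun j => Ideal.Quotient.mk_surjective (b.repr (Submodule.Quotient.mk x) j)
    have hx : (Submodule.Quotient.mk x : Y ⧸ 𝔭 • (⊤ : Submodule A Y)) =
        Submodule.Quotient.mk (∑ j, c j • y j) := by
      rw [← b.sum_repr (Submodule.Quotient.mk x), ← Submodule.mkQ_apply _ (∑ j, c j • y j),
        map_sum]
      refine Finset.sum_congr rfl fun j _ => ?_
      rw [← hc, ← hy]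
      rfl
    rw [Submodule.Quotient.eq] at hx
    rw [← sub_add_cancel x (∑ j, c j • y j), add_comm]
    exact Submodule.add_mem_sup (Submodule.sum_mem _ fun j _ =>
      P.smul_mem _ (Submodule.subset_span ⟨j, rfl⟩)) hx
  obtain ⟨a, ha, haP⟩ := Submodule.exists_sub_one_mem_and_smul_le_of_fg_of_le_sup
    (Module.Finite.fg_top (R := A) (M := Y)) le_rfl hP
  have ha0 : a ≠ 0 := by
    rintro rfl
    rw [zero_sub, neg_mem_iff] at ha
    exact h𝔭.ne_top ((Ideal.eq_top_iff_one _).2 ha)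
  have hspan : ⊤ ≤ Submodule.span K (Set.range fun j => (y j : Fin r → K)) := by
    have hlat : IsLattice (P.map Y.subtype) := by
      refine hY.of_smul_le (Submodule.map_subtype_le _ _) ha0 fun x hx => ?_
      exact ⟨a • ⟨x, hx⟩, haP (Submodule.smul_mem_pointwise_smul _ _ _ Submodule.mem_top), rfl⟩
    rw [← hlat.2, Submodule.span_le, Submodule.map_span, ← Set.range_comp]
    exact Submodule.span_subset_span A K _
  have hli : LinearIndependent K fun j => (y j : Fin r → K) := by
    rw [Fintype.linearIndependent_iff]
    intro f hf
    by_contra! hne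
    obtain ⟨j, hj⟩ := hne
    obtain ⟨x, hx, l, -, hl⟩ := Ideal.exist_integer_multiples_notMem h𝔭.ne_top Finset.univ f
      (Finset.mem_univ j) hj
    choose c hc using fun i => hx i (Finset.mem_univ i)
    have hsum : ∑ i, c i • y i = 0 := by
      refine Y.subtype_injective ?_
      rw [map_sum, map_zero, ← smul_zero x, ← hf, Finset.smul_sum]
      refine Finset.sum_congr rfl fun i _ => ?_
      rw [map_smul, ← algebraMap_smul K (c i), hc, mul_smul, Submodule.subtype_apply]
    have hb := Fintype.linearIndependent_iff.1 b.linearIndependent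
      (fun i => Ideal.Quotient.mk 𝔭 (c i)) (by
        have h := congrArg (Submodule.mkQ (𝔭 • (⊤ : Submodule A Y))) hsum
        rw [map_sum, map_zero] at h
        rw [← h]
        refine Finset.sum_congr rfl fun i _ => ?_
        rw [← hy]
        rfl) l
    exact hl ((FractionalIdeal.mem_coeIdeal _).2
      ⟨c l, Ideal.Quotient.eq_zero_iff_mem.1 hb, hc l⟩)
  have := Module.finrank_eq_card_basis (Module.Basis.mk hli hspan)
  simpa using this.symm

end Lattices

section Counting

theorem exists_linearEquiv_apply_eq {k W : Type*} [Field k] [AddCommGroup W] [Module k W]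
    {s s' : W} (hs : s ≠ 0) (hs' : s' ≠ 0) : ∃ φ : W ≃ₗ[k] W, φ s = s' := by
  let f := (LinearEquiv.toSpanNonzeroSingleton k W s hs).symm ≪≫ₗ
    LinearEquiv.toSpanNonzeroSingleton k W s' hs'
  obtain ⟨φ, hφ⟩ := Submodule.exists_linearEquiv_restrict_eq f
  refine ⟨φ, ?_⟩
  have h := hφ (LinearEquiv.toSpanNonzeroSingleton k W s hs 1)
  have h1 : (LinearEquiv.toSpanNonzeroSingleton k W s hs).symm
      ⟨s, Submodule.mem_span_singleton_self s⟩
      = 1 := by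
    rw [LinearEquiv.symm_apply_eq]
    simp
  simpa [f, h1] using h.symm

variable {Y Y' Z : Submodule A (Fin r → K)} {𝔭 : Ideal A} {i : ℕ}

/-- The image in `Y / 𝔭Y` of a submodule of `V`. -/
def imageModSMul (𝔭 : Ideal A) (Y Z : Submodule A (Fin r → K)) :
    Submodule A (Y ⧸ 𝔭 • (⊤ : Submodule A Y)) :=
  (Z.comap Y.subtype).map (𝔭 • (⊤ : Submodule A Y)).mkQ

theorem comap_imageModSMul (h : 𝔭 • Y ≤ Z) :
    (imageModSMul 𝔭 Y Z).comap (𝔭 • (⊤ : Submodule A Y)).mkQ = Z.comap Y.subtype := by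
  rw [imageModSMul, Submodule.comap_map_mkQ, sup_eq_right, ← comap_subtype_smul]
  exact Submodule.comap_mono h

theorem mk_mem_imageModSMul_iff (h : 𝔭 • Y ≤ Z) {s : Fin r → K} (hs : s ∈ Y) :
    Submodule.Quotient.mk ⟨s, hs⟩ ∈ imageModSMul 𝔭 Y Z ↔ s ∈ Z := by
  rw [← Submodule.mkQ_apply, ← Submodule.mem_comap, comap_imageModSMul h]
  rfl

theorem card_imageModSMul (h : Z ≤ Y) :
    Nat.card (imageModSMul 𝔭 Y Z) = Nat.card (Z ⧸ Submodule.comap Z.subtype (𝔭 • Y)) := by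
  let f := (𝔭 • (⊤ : Submodule A Y)).mkQ ∘ₗ Submodule.inclusion h
  have hrange : LinearMap.range f = imageModSMul 𝔭 Y Z := by
    rw [LinearMap.range_comp, Submodule.range_inclusion, imageModSMul]
  have hker : LinearMap.ker f = Submodule.comap Z.subtype (𝔭 • Y) := by
    rw [LinearMap.ker_comp, Submodule.ker_mkQ, ← comap_subtype_smul, ← Submodule.comap_comp]
    rfl
  rw [← hrange, ← hker]
  exact (Nat.card_congr f.quotKerEquivRange.toEquiv).symm

theorem injOn_imageModSMul : Set.InjOn (imageModSMul 𝔭 Y) (lset 𝔭 Y i) := by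
  intro Z hZ Z' hZ' h
  have h' := congrArg (Submodule.comap (𝔭 • (⊤ : Submodule A Y)).mkQ) h
  rw [comap_imageModSMul hZ.1, comap_imageModSMul hZ'.1] at h'
  have h'' := congrArg (Submodule.map Y.subtype) h'
  rwa [Submodule.map_comap_subtype, Submodule.map_comap_subtype, inf_eq_right.2 hZ.2.1,
    inf_eq_right.2 hZ'.2.1] at h''

theorem exists_imageModSMul_eq (U : Submodule A (Y ⧸ 𝔭 • (⊤ : Submodule A Y))) :
    ∃ Z, 𝔭 • Y ≤ Z ∧ Z ≤ Y ∧ imageModSMul 𝔭 Y Z = U := by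
  refine ⟨(U.comap (𝔭 • (⊤ : Submodule A Y)).mkQ).map Y.subtype, ?_,
    Submodule.map_subtype_le _ _, ?_⟩
  · have h : 𝔭 • Y = (𝔭 • (⊤ : Submodule A Y)).map Y.subtype := by
      rw [Submodule.map_smul'', Submodule.map_top, Submodule.range_subtype]
    exact h.trans_le (Submodule.map_mono (Submodule.le_comap_mkQ _ _))
  · rw [imageModSMul, Submodule.comap_map_eq_of_injective Y.subtype_injective,
      Submodule.map_comap_eq_of_surjective (Submodule.mkQ_surjective _)]

theorem finite_lset [Finite (Y ⧸ 𝔭 • (⊤ : Submodule A Y))] : (lset 𝔭 Y i).Finite := by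
  have : Finite (Submodule A (Y ⧸ 𝔭 • (⊤ : Submodule A Y))) :=
    Finite.of_injective _ SetLike.coe_injective
  exact Set.Finite.of_finite_image (Set.toFinite _) injOn_imageModSMul

theorem ncard_lset_mem {s : Fin r → K} (hs : s ∈ Y) :
    {Z ∈ lset 𝔭 Y i | s ∈ Z}.ncard =
      {U : Submodule A (Y ⧸ 𝔭 • (⊤ : Submodule A Y)) | Nat.card U = Nat.card (A ⧸ 𝔭) ^ i ∧
        Submodule.Quotient.mk ⟨s, hs⟩ ∈ U}.ncard := by
  rw [← (injOn_imageModSMul.mono (Set.sep_subset _ _)).ncard_image]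
  congr 1
  ext U
  constructor
  · rintro ⟨Z, ⟨⟨h1, h2, h3⟩, hsZ⟩, rfl⟩
    exact ⟨(card_imageModSMul h2).trans h3, (mk_mem_imageModSMul_iff h1 hs).2 hsZ⟩
  · rintro ⟨hU, hsU⟩
    obtain ⟨Z, h1, h2, rfl⟩ := exists_imageModSMul_eq U
    exact ⟨Z, ⟨⟨h1, h2, (card_imageModSMul h2).symm.trans hU⟩,
      (mk_mem_imageModSMul_iff h1 hs).1 hsU⟩, rfl⟩

theorem ncard_lset_mem_eq (h𝔭 : 𝔭.IsMaximal) {s s' : Fin r → K} (hs : s ∈ Y) (hs' : s' ∈ Y)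
    (hs0 : s ∉ 𝔭 • Y) (hs0' : s' ∉ 𝔭 • Y) :
    {Z ∈ lset 𝔭 Y i | s ∈ Z}.ncard = {Z ∈ lset 𝔭 Y i | s' ∈ Z}.ncard := by
  let _ := Ideal.Quotient.field 𝔭
  have hne : ∀ {s : Fin r → K} (hs : s ∈ Y), s ∉ 𝔭 • Y →
      (Submodule.Quotient.mk ⟨s, hs⟩ : Y ⧸ 𝔭 • (⊤ : Submodule A Y)) ≠ 0 := by
    intro s hs h0 h
    rw [Submodule.Quotient.mk_eq_zero, ← comap_subtype_smul] at h
    exact h0 h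
  obtain ⟨φ, hφ⟩ := exists_linearEquiv_apply_eq (k := A ⧸ 𝔭) (hne hs hs0) (hne hs' hs0')
  let ψ := φ.restrictScalars A
  rw [ncard_lset_mem hs, ncard_lset_mem hs',
    ← Set.ncard_image_of_injective _ (Submodule.map_injective_of_injective ψ.injective)]
  congr 1
  ext U
  constructor
  · rintro ⟨U, ⟨hU, hsU⟩, rfl⟩
    exact ⟨(Nat.card_congr (ψ.submoduleMap U).toEquiv).symm.trans hU, _, hsU, hφ⟩
  · rintro ⟨hU, hsU⟩
    refine ⟨U.comap ψ.toLinearMap, ⟨?_, ?_⟩, Submodule.map_comap_eq_of_surjective ψ.surjective _⟩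
    · exact (Nat.card_congr (ψ.ofSubmodule' U).toEquiv).trans hU
    · rw [Submodule.mem_comap]
      exact hφ.symm ▸ hsU

/-- Double counting of the pairs `(s, Z)` with `s ∈ Z`, `s ∉ 𝔭Y` and `Z ∈ ℒ(Y, 𝔭, i)`. -/
theorem card_lset_mul_eq (h𝔭 : 𝔭.IsMaximal) {S : Finset (Fin r → K)}
    (hS : IsRepSet (𝔭 • Y) Y S) (h0 : (0 : Fin r → K) ∈ S) {L : Finset (Submodule A (Fin r → K))}
    (hL : (L : Set (Submodule A (Fin r → K))) = lset 𝔭 Y i) {s : Fin r → K} (hs : s ∈ Y)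
    (hs0 : s ∉ 𝔭 • Y) :
    L.card * (Nat.card (A ⧸ 𝔭) ^ i - 1) = (L.filter (s ∈ ·)).card * (S.card - 1) := by
  have hL' : ∀ Z, Z ∈ L ↔ Z ∈ lset 𝔭 Y i := fun Z => by rw [← hL, Finset.mem_coe]
  have h := Finset.sum_card_bipartiteAbove_eq_sum_card_bipartiteBelow
    (s := S.erase 0) (t := L) (fun w Z => w ∈ Z)
  rw [Finset.sum_const_nat (m := (L.filter (s ∈ ·)).card),
    Finset.sum_const_nat (m := Nat.card (A ⧸ 𝔭) ^ i - 1), Finset.card_erase_of_mem h0] at h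
  · rw [← h, mul_comm]
  · intro Z hZ
    have hZ' := (hL' Z).1 hZ
    have herase : (S.erase 0).filter (· ∈ Z) = (S.filter (· ∈ Z)).erase 0 := by
      ext
      simp [and_assoc]
    rw [← hZ'.2.2, ← (hS.filter_mem hZ'.1 hZ'.2.1).card_eq, Finset.bipartiteBelow, herase,
      Finset.card_erase_of_mem (by simp [h0])]
  · intro w hw
    obtain ⟨hw0, hw⟩ := Finset.mem_erase.1 hw
    have hcard : ∀ w, (L.filter (w ∈ ·)).card = {Z ∈ lset 𝔭 Y i | w ∈ Z}.ncard := by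
      intro w
      rw [← Set.ncard_coe_finset]
      congr 1
      ext Z
      simp [hL']
    rw [Finset.bipartiteAbove, hcard, hcard]
    exact ncard_lset_mem_eq h𝔭 (hS.1 w hw) hs
      (fun h => hw0 (hS.eq_zero_of_mem h0 hw h)) hs0

end Counting

section HeckeAction

variable {Y Y' : Submodule A (Fin r → K)} {𝔭 : Ideal A} {i : ℕ}

theorem finite_quotient_of_span_eq_top (hfin : ∀ I : Ideal A, I ≠ ⊥ → Finite (A ⧸ I))
    (hY : Submodule.span K (Y : Set (Fin r → K)) = ⊤) (hY' : Y'.FG) :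
    Finite (Y' ⧸ Submodule.comap Y'.subtype Y) := by
  obtain ⟨a, ha, haY⟩ := exists_ne_zero_smul_mem hY hY'
  have : Module.Finite A Y' := Module.Finite.iff_fg.2 hY'
  have : Finite (A ⧸ Ideal.span {a}) := hfin _ (by simpa using ha)
  have : Finite (Y' ⧸ Ideal.span {a} • (⊤ : Submodule A Y')) :=
    Module.finite_of_finite (A ⧸ Ideal.span {a})
  have hle : Ideal.span {a} • (⊤ : Submodule A Y') ≤ Submodule.comap Y'.subtype Y := by
    refine Submodule.smul_le.2 fun b hb y _ => ?_
    obtain ⟨c, rfl⟩ := Ideal.mem_span_singleton'.1 hb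
    rw [mul_smul]
    exact Submodule.smul_mem _ c (haY y.1 y.2)
  exact Finite.of_surjective _ (Submodule.factor_surjective hle)

theorem sum_disc_eq (hfin : ∀ I : Ideal A, I ≠ ⊥ → Finite (A ⧸ I)) {M : Type*} [AddCommGroup M]
    {g : (Fin r → K) → Submodule A (Fin r → K) → M} (hg : IsDerivedDistribution g)
    (hY : IsLattice Y) (hY' : IsLattice Y') (hle : Y ≤ Y') (h𝔭 : 𝔭.IsMaximal)
    (htor : ∀ y ∈ Y', (∀ a ∈ 𝔭, a • y ∈ Y) → y ∈ Y) {S : Finset (Fin r → K)}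
    (hS : IsRepSet (𝔭 • Y) Y S) (h0 : (0 : Fin r → K) ∈ S) {L : Finset (Submodule A (Fin r → K))}
    (hL : ∀ Z ∈ L, 𝔭 • Y ≤ Z ∧ Z ≤ Y) {m : ℕ} (hmL : m ≤ L.card)
    (hm : ∀ s ∈ S, s ≠ 0 → (L.filter (s ∈ ·)).card = m) :
    ∑ Z ∈ L, disc g Z (Z ⊔ 𝔭 • Y') =
      (L.card - m) • (disc g (𝔭 • Y) (𝔭 • Y') - disc g Y Y') + L.card • disc g Y Y' := by
  rcases eq_or_ne 𝔭 ⊥ with rfl | h𝔭0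
  · have hYY : Y = Y' := le_antisymm hle fun y hy => htor y hy (by simp)
    subst hYY
    simp [disc_self]
  obtain ⟨a, ha𝔭, ha0⟩ := Submodule.exists_mem_ne_zero_of_ne_bot h𝔭0
  have hlat : ∀ {Y Z : Submodule A (Fin r → K)}, IsLattice Y → 𝔭 • Y ≤ Z → Z ≤ Y → IsLattice Z :=
    fun hY hZ hZ' => hY.of_smul_le hZ' ha0 fun y hy => hZ (Submodule.smul_mem_smul ha𝔭 hy)
  have h𝔭Y : IsLattice (𝔭 • Y) := hlat hY le_rfl Submodule.smul_le_right
  have h𝔭Y' : IsLattice (𝔭 • Y') := hlat hY' le_rfl Submodule.smul_le_right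
  obtain ⟨t, ht, ht1⟩ := exists_smul_mem_of_torsion_eq_bot hY.2 hY'.1 h𝔭 htor
  obtain ⟨hsup, hinf⟩ := le_sup_smul_and_inf_smul_le ht ht1
  have := finite_quotient_of_span_eq_top hfin h𝔭Y.2 h𝔭Y'.1
  obtain ⟨R, hR, hR0⟩ := exists_isRepSet (Y := 𝔭 • Y) (Y' := 𝔭 • Y')
  have hRY : IsRepSet Y Y' R := hR.mono Submodule.smul_le_right hsup Submodule.smul_le_right hinf
  have hRZ : ∀ Z ∈ L, IsRepSet Z (Z ⊔ 𝔭 • Y') R := fun Z hZ =>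
    hR.mono le_sup_right le_rfl (hL Z hZ).1 ((inf_le_inf_left _ (hL Z hZ).2).trans hinf)
  have key : ∀ w ∈ R, ∑ Z ∈ L, g w Z = (L.card - m) • g w (𝔭 • Y) + m • g w Y := by
    intro w hw
    rcases eq_or_ne w 0 with rfl | hw0
    · rw [hg.1 0 _ h𝔭Y (Submodule.zero_mem _), hg.1 0 _ hY (Submodule.zero_mem _),
        Finset.sum_eq_zero fun Z hZ =>
          hg.1 0 Z (hlat hY (hL Z hZ).1 (hL Z hZ).2) Z.zero_mem]
      simp
    have hwY : w ∉ Y := fun h => hw0 (hRY.eq_zero_of_mem hR0 hw h)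
    let D : (Fin r → K) → M := fun s => g (w + s) (𝔭 • Y) - g s (𝔭 • Y)
    have hD0 : D 0 = g w (𝔭 • Y) := by
      simp [D, hg.1 0 _ h𝔭Y (Submodule.zero_mem _)]
    have hgY : g w Y = D 0 + ∑ s ∈ S.erase 0, D s := by
      rw [Finset.add_sum_erase S D h0]
      exact hg.apply_eq_sum h𝔭Y hY Submodule.smul_le_right hS h0 hwY
    have hgZ : ∀ Z ∈ L, g w Z = ∑ s ∈ S, if s ∈ Z then D s else 0 := by
      intro Z hZ
      obtain ⟨h1, h2⟩ := hL Z hZ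
      rw [← Finset.sum_filter]
      exact hg.apply_eq_sum h𝔭Y (hlat hY h1 h2) h1 (hS.filter_mem h1 h2)
        (by simp [h0]) fun h => hwY (h2 h)
    rw [Finset.sum_congr rfl hgZ, Finset.sum_comm]
    have hinner : ∀ s, (∑ Z ∈ L, if s ∈ Z then D s else 0) = (L.filter (s ∈ ·)).card • D s := by
      intro s
      rw [← Finset.sum_filter, Finset.sum_const]
    simp_rw [hinner]
    rw [← Finset.add_sum_erase S _ h0, Finset.sum_congr (g := fun s => m • D s) rfl fun s hs => by
      rw [hm s (Finset.mem_of_mem_erase hs) (Finset.ne_of_mem_erase hs)]]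
    rw [← Finset.smul_sum, hgY, smul_add, ← add_assoc, ← hD0, ← add_smul, Nat.sub_add_cancel hmL]
    simp
  have hdisc : ∀ Z ∈ L, disc g Z (Z ⊔ 𝔭 • Y') = -∑ w ∈ R, g w Z := fun Z hZ =>
    hg.disc_eq (hlat hY (hL Z hZ).1 (hL Z hZ).2) (hRZ Z hZ) hR0
  rw [Finset.sum_congr rfl hdisc, Finset.sum_neg_distrib, Finset.sum_comm,
    Finset.sum_congr rfl key, Finset.sum_add_distrib, ← Finset.smul_sum, ← Finset.smul_sum,
    hg.disc_eq h𝔭Y hR hR0, hg.disc_eq hY hRY hR0]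
  obtain ⟨e, he⟩ := Nat.exists_eq_add_of_le hmL
  rw [he, Nat.add_sub_cancel_left, add_smul, smul_sub, smul_neg, smul_neg, smul_neg]
  abel

end HeckeAction

/-- Multiplicative (here: additive, since `M` is written additively)
Hecke action on discriminants of derived distributions:
with `c = #ℒ(Y,𝔭,i)` and `m = c (q^{di}-1)/(q^{dr}-1)` (an integer),
`∑_{Z ∈ ℒ(Y,𝔭,i)} Disc(g)^{Z'|Z} = (c-m)•(Disc(g)^{𝔭Y'|𝔭Y} - Disc(g)^{Y'|Y}) + c•Disc(g)^{Y'|Y}`,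
and `e = c - m` equals `c·q^{di}(q^{d(r-i)}-1)/(q^{dr}-1)`. -/
theorem statement2
    {p q : ℕ} (hp : p.Prime) (hq : ∃ n : ℕ, 0 < n ∧ q = p ^ n)
    {F : Type*} [Field F] [Fintype F] (hF : Fintype.card F = q) [Algebra F A]
    (hfin : ∀ I : Ideal A, I ≠ ⊥ → Finite (A ⧸ I))
    (hr : 1 ≤ r)
    {M : Type*} [AddCommGroup M]
    (g : (Fin r → K) → Submodule A (Fin r → K) → M)
    (hg : IsDerivedDistribution g)
    (Y Y' : Submodule A (Fin r → K)) (hY : IsLattice Y) (hY' : IsLattice Y')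
    (hle : Y ≤ Y')
    (𝔭 : Ideal A) (h𝔭 : 𝔭.IsMaximal)
    (d : ℕ) (hd : Nat.card (A ⧸ 𝔭) = q ^ d)
    (htor : ∀ y ∈ Y', (∀ a ∈ 𝔭, a • y ∈ Y) → y ∈ Y)
    (i : ℕ) (hi0 : 0 < i) (hir : i < r) :
    (q ^ (d * r) - 1) ∣ Nat.card (lset 𝔭 Y i) * (q ^ (d * i) - 1) ∧
    (q ^ (d * r) - 1) ∣ Nat.card (lset 𝔭 Y i) * q ^ (d * i) * (q ^ (d * (r - i)) - 1) ∧
    (∑ᶠ Z ∈ lset 𝔭 Y i, disc g Z (Z ⊔ 𝔭 • Y')) =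
      (Nat.card (lset 𝔭 Y i) -
          Nat.card (lset 𝔭 Y i) * (q ^ (d * i) - 1) / (q ^ (d * r) - 1)) •
        (disc g (𝔭 • Y) (𝔭 • Y') - disc g Y Y') +
      (Nat.card (lset 𝔭 Y i)) • disc g Y Y' ∧
    Nat.card (lset 𝔭 Y i) -
        Nat.card (lset 𝔭 Y i) * (q ^ (d * i) - 1) / (q ^ (d * r) - 1) =
      Nat.card (lset 𝔭 Y i) * q ^ (d * i) * (q ^ (d * (r - i)) - 1) / (q ^ (d * r) - 1) := by
  obtain ⟨n, -, rfl⟩ := hq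
  have hN1 : Nat.card (A ⧸ 𝔭) ≠ 0 := by
    rw [hd]
    exact pow_ne_zero _ (pow_ne_zero _ hp.ne_zero)
  have : Finite (A ⧸ 𝔭) := Nat.finite_of_card_ne_zero hN1
  let _ := Ideal.Quotient.field 𝔭
  have hN : 1 < Nat.card (A ⧸ 𝔭) := Finite.one_lt_card
  simp only [pow_mul _ d, ← hd]
  set N := Nat.card (A ⧸ 𝔭)
  have : Module.Finite A Y := Module.Finite.iff_fg.2 hY.1
  have : Finite (Y ⧸ 𝔭 • (⊤ : Submodule A Y)) := Module.finite_of_finite (A ⧸ 𝔭)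
  have : Finite (Y ⧸ Submodule.comap Y.subtype (𝔭 • Y)) := by rwa [comap_subtype_smul]
  obtain ⟨S, hS, h0⟩ := exists_isRepSet (Y := 𝔭 • Y) (Y' := Y)
  have hScard : S.card = N ^ r := by
    rw [hS.card_eq, comap_subtype_smul, Module.natCard_eq_pow_finrank (K := A ⧸ 𝔭),
      hY.finrank_quotient h𝔭]
  let L := (finite_lset (Y := Y) (𝔭 := 𝔭) (i := i)).toFinset
  have hL : (L : Set (Submodule A (Fin r → K))) = lset 𝔭 Y i := Set.Finite.coe_toFinset _
  have hc : Nat.card (lset 𝔭 Y i) = L.card := by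
    rw [← hL]
    simp
  have hNr : 1 < N ^ r := Nat.one_lt_pow (by omega) hN
  obtain ⟨s, hs, hs0⟩ : ∃ s ∈ S, s ≠ 0 := S.exists_mem_ne (by omega) 0
  have hcount : ∀ s ∈ S, s ≠ 0 →
      L.card * (N ^ i - 1) = (L.filter (s ∈ ·)).card * (N ^ r - 1) := fun s hs hs0 => by
    rw [← hScard]
    exact card_lset_mul_eq h𝔭 hS h0 hL (hS.1 s hs) fun h => hs0 (hS.eq_zero_of_mem h0 hs h)
  set m := (L.filter (s ∈ ·)).card
  have hm : L.card * (N ^ i - 1) = m * (N ^ r - 1) := hcount s hs hs0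
  have hmL : m ≤ L.card := Finset.card_filter_le _ _
  have he : L.card * N ^ i * (N ^ (r - i) - 1) = (L.card - m) * (N ^ r - 1) := by
    have hNi : 0 < N ^ i := Nat.pow_pos (by omega)
    rw [Nat.sub_mul, ← hm, mul_assoc, Nat.mul_sub, ← pow_add, Nat.add_sub_of_le hir.le,
      ← Nat.mul_sub]
    congr 1
    omega
  have hpos : 0 < N ^ r - 1 := by omega
  rw [hc, hm, he, Nat.mul_div_cancel _ hpos, Nat.mul_div_cancel _ hpos]
  refine ⟨dvd_mul_left _ _, dvd_mul_left _ _, ?_, rfl⟩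
  rw [finsum_mem_eq_finite_toFinset_sum _ finite_lset]
  refine sum_disc_eq hfin hg hY hY' hle h𝔭 htor hS h0 (fun Z hZ => ?_) hmL fun s' hs' hs0' => ?_
  · have hZ' : Z ∈ lset 𝔭 Y i := by rwa [← hL]
    exact ⟨hZ'.1, hZ'.2.1⟩
  · exact Nat.eq_of_mul_eq_mul_right hpos ((hcount s' hs' hs0').symm.trans hm)
end
end

section
/- Let Λ be an A-lattice of rank r in L and u ∈ K·Λ. Then the finite products ∏_{0≠λ∈u+Λ, log λ ≤ N} ⟨λ⟩ converge, as the rational number N tends to +∞, to a limit U_{u,Λ} ∈ L^× satisfying |U_{u,Λ} − 1| < 1, and U_{u,Λ} depends only on the class of u modulo Λ. -/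
open scoped Classical

noncomputable section

variable {Fq : Type*} [Field Fq] [Fintype Fq]
variable {L : Type*} [NormedField L] [CompleteSpace L]
variable [Algebra (Polynomial Fq) L]

/-- `log_q |z|`. -/
def logq (q : ℕ) (z : L) : ℝ := Real.logb q ‖z‖

/-- An `A = 𝔽_q[T]`-lattice of rank `r` in `L`: a finitely generated `A`-submodule which is
free of rank `r` (equivalently: its `𝔽_q(T)`-span has dimension `r`), and which is
discrete in `L` (finite intersection with every bounded ball). -/
def IsLatticeOfRank (r : ℕ) (Λ : Submodule (Polynomial Fq) L) : Prop :=
  (∃ b : Fin r → L, LinearIndependent (Polynomial Fq) b ∧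
      Submodule.span (Polynomial Fq) (Set.range b) = Λ) ∧
  ∀ B : ℝ, {x : L | x ∈ Λ ∧ ‖x‖ ≤ B}.Finite

/-- Membership in `K·Λ`, the `K = 𝔽_q(T)`-span of `Λ` in `L`. -/
def InKSpan (Λ : Submodule (Polynomial Fq) L) (u : L) : Prop :=
  ∃ n : Polynomial Fq, n ≠ 0 ∧ n • u ∈ Λ

/-- The exponential function of the lattice `Λ`: `e^Λ(z) = z·∏_{0≠λ∈Λ} (1 - z/λ)`. -/
def latExp (Λ : Submodule (Polynomial Fq) L) (z : L) : L :=
  z * ∏' l : {x : L // x ∈ Λ ∧ x ≠ 0}, (1 - z / (l : L))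

/-- The set of nonzero `λ ∈ u + Λ` with `log λ ≤ N` (a finite set for a lattice `Λ`). -/
def ballSet (q : ℕ) (Λ : Submodule (Polynomial Fq) L) (u : L) (N : ℚ) : Set L :=
  {l : L | l ≠ 0 ∧ l - u ∈ Λ ∧ logq q l ≤ (N : ℝ)}

/-- The rational number `s` with `|z| = q^s` (whenever it exists; `0` otherwise). -/
def rlog (q : ℕ) (z : L) : ℚ :=
  if h : ∃ s : ℚ, ‖z‖ = (q : ℝ) ^ (s : ℝ) then h.choose else 0

/-- The `1`-unit part `⟨z⟩ = z·ρ(log z)·sgn(z)⁻¹` of `z ∈ L^×`, relative to a compatible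
system `ρ` of rational powers of the uniformizer `π = T⁻¹` and a sign function `sgn`. -/
def uPart (q : ℕ) (ρ : ℚ → L) (sgn : L → L) (z : L) : L :=
  z * ρ (rlog q z) * (sgn z)⁻¹

open Filter Topology Polynomial

section OneUnits

variable {E : Type*} [NormedField E]

/-- In characteristic `p`, the only root of unity which is a `1`-unit is `1`. -/
theorem eq_one_of_pow_eq_one_of_norm_sub_one_lt (p : ℕ) [Fact p.Prime] [CharP E p] {z : E}
    {k : ℕ} (hk : 0 < k) (hz : z ^ k = 1) (h : ‖z - 1‖ < 1) : z = 1 := by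
  by_contra hne
  have hpos : 0 < ‖z - 1‖ := norm_pos_iff.mpr (sub_ne_zero.mpr hne)
  have hinj : Function.Injective fun n : ℕ => z ^ p ^ n := by
    intro m n hmn
    have h1 : ‖z - 1‖ ^ p ^ m = ‖z - 1‖ ^ p ^ n := by
      rw [← norm_pow, ← norm_pow, sub_pow_char_pow, sub_pow_char_pow, one_pow, one_pow]
      exact congrArg (fun x => ‖x - 1‖) hmn
    exact Nat.pow_right_injective (Fact.out : p.Prime).two_le
      (pow_right_injective₀ hpos h.ne h1)
  refine Set.infinite_of_injective_forall_mem (s := {x : E | x ^ k = 1}) hinj ?_ ?_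
  · intro n
    change (z ^ p ^ n) ^ k = 1
    rw [← pow_mul, mul_comm, pow_mul, hz, one_pow]
  · refine (Polynomial.nthRoots k (1 : E)).toFinset.finite_toSet.subset fun x hx => ?_
    simpa [Polynomial.mem_nthRoots hk] using hx

variable [IsUltrametricDist E]

theorem norm_eq_one_of_norm_sub_one_lt {x : E} (hx : ‖x - 1‖ < 1) : ‖x‖ = 1 := by
  have h := IsUltrametricDist.norm_add_eq_max_of_norm_ne_norm (x := x - 1) (y := (1 : E))
    (by rw [norm_one]; exact hx.ne)
  rw [sub_add_cancel, norm_one, max_eq_right hx.le] at h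
  exact h

theorem norm_mul_sub_one_le {c : ℝ} (hc : c < 1) {x y : E} (hx : ‖x - 1‖ ≤ c)
    (hy : ‖y - 1‖ ≤ c) : ‖x * y - 1‖ ≤ c := by
  have h : x * y - 1 = x * (y - 1) + (x - 1) := by ring
  rw [h]
  refine (IsUltrametricDist.norm_add_le_max _ _).trans (max_le ?_ hx)
  rw [norm_mul, norm_eq_one_of_norm_sub_one_lt (hx.trans_lt hc), one_mul]
  exact hy

theorem norm_inv_sub_one {x : E} (hx : ‖x - 1‖ < 1) : ‖x⁻¹ - 1‖ = ‖x - 1‖ := by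
  have hx1 := norm_eq_one_of_norm_sub_one_lt hx
  have hx0 : x ≠ 0 := norm_ne_zero_iff.mp (by simp [hx1])
  have h : x⁻¹ - 1 = x⁻¹ * -(x - 1) := by field_simp; ring
  rw [h, norm_mul, norm_inv, hx1, norm_neg, inv_one, one_mul]

theorem norm_prod_sub_one_le {ι : Type*} {c : ℝ} (hc0 : 0 ≤ c) (hc : c < 1) (s : Finset ι)
    (f : ι → E) (hf : ∀ i ∈ s, ‖f i - 1‖ ≤ c) : ‖∏ i ∈ s, f i - 1‖ ≤ c :=
  Finset.prod_induction f (fun x => ‖x - 1‖ ≤ c) (fun _ _ => norm_mul_sub_one_le hc)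
    (by simpa using hc0) hf

/-- A multiplicative retraction of `E^×` onto the group of `1`-units. -/
structure IsOneUnitProjection (f : E → E) : Prop where
  map_mul : ∀ x y : E, x ≠ 0 → y ≠ 0 → f (x * y) = f x * f y
  norm_sub_one_lt : ∀ x : E, x ≠ 0 → ‖f x - 1‖ < 1
  map_of_norm_sub_one_lt : ∀ x : E, ‖x - 1‖ < 1 → f x = x

theorem IsOneUnitProjection.map_add {f : E → E} (hf : IsOneUnitProjection f) {x y : E}
    (hyx : ‖y‖ < ‖x‖) : f (x + y) = f x * (1 + y / x) := by
  have hx0 : 0 < ‖x‖ := (norm_nonneg y).trans_lt hyx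
  have hx : x ≠ 0 := norm_pos_iff.mp hx0
  have h1 : ‖(1 + y / x) - 1‖ < 1 := by
    rw [add_sub_cancel_left, norm_div]
    exact (div_lt_one hx0).mpr hyx
  have h2 : 1 + y / x ≠ 0 := by
    refine norm_ne_zero_iff.mp ?_
    rw [norm_eq_one_of_norm_sub_one_lt h1]
    exact one_ne_zero
  have h3 : x + y = x * (1 + y / x) := by field_simp
  rw [h3, hf.map_mul _ _ hx h2, hf.map_of_norm_sub_one_lt _ h1]

end OneUnits

section UnitPart

variable {E : Type*} [NormedField E]

theorem norm_eq_rpow_rlog {q : ℕ} (hval : ∀ x : E, x ≠ 0 → ∃ s : ℚ, ‖x‖ = (q : ℝ) ^ (s : ℝ))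
    {z : E} (hz : z ≠ 0) : ‖z‖ = (q : ℝ) ^ (rlog q z : ℝ) := by
  rw [rlog, dif_pos (hval z hz)]
  exact (hval z hz).choose_spec

theorem rlog_eq_of_norm_eq {q : ℕ} (hq : 1 < q) {z : E} {s : ℚ}
    (hz : ‖z‖ = (q : ℝ) ^ (s : ℝ)) : rlog q z = s := by
  have h : ∃ s : ℚ, ‖z‖ = (q : ℝ) ^ (s : ℝ) := ⟨s, hz⟩
  have hq' : (1 : ℝ) < q := by exact_mod_cast hq
  rw [rlog, dif_pos h]
  have h1 := h.choose_spec.symm.trans hz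
  exact_mod_cast (Real.rpow_right_inj (by linarith) hq'.ne').mp h1

/-- The uniformizer has trivial `1`-unit part. -/
theorem uPart_eq_one_of_mul_eq_one (p : ℕ) [Fact p.Prime] [CharP E p] {q : ℕ} (hq : 1 < q)
    {ρ : ℚ → E} {sgn : E → E} {t : E} (ht : ‖t‖ = q) (hρ1 : ρ 1 * t = 1)
    (hsgn : ∀ z : E, z ≠ 0 →
      (∃ k : ℕ, 0 < k ∧ sgn z ^ k = 1) ∧ ‖uPart q ρ sgn z - 1‖ < 1) :
    uPart q ρ sgn t = 1 := by
  have ht0 : t ≠ 0 := right_ne_zero_of_mul_eq_one hρ1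
  obtain ⟨⟨k, hk, hkt⟩, hut⟩ := hsgn t ht0
  have hlog : rlog q t = 1 := rlog_eq_of_norm_eq hq (by simp [ht])
  have hu : uPart q ρ sgn t = (sgn t)⁻¹ := by rw [uPart, hlog, mul_comm t, hρ1, one_mul]
  refine eq_one_of_pow_eq_one_of_norm_sub_one_lt p hk ?_ hut
  rw [hu, inv_pow, hkt, inv_one]

variable [IsUltrametricDist E]

/-- `z ↦ ⟨z⟩` is a multiplicative retraction onto the `1`-units. -/
theorem isOneUnitProjection_uPart (p : ℕ) [Fact p.Prime] [CharP E p] {q : ℕ} (hq : 1 < q)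
    (hval : ∀ x : E, x ≠ 0 → ∃ s : ℚ, ‖x‖ = (q : ℝ) ^ (s : ℝ))
    {ρ : ℚ → E} {sgn : E → E} (hρ : ∀ x y : ℚ, ρ (x + y) = ρ x * ρ y) (hρ1 : ρ 1 ≠ 0)
    (hsgn : ∀ z : E, z ≠ 0 →
      (∃ k : ℕ, 0 < k ∧ sgn z ^ k = 1) ∧ ‖uPart q ρ sgn z - 1‖ < 1) :
    IsOneUnitProjection (uPart q ρ sgn) := by
  have hρ0 : ρ 0 = 1 := by
    have h := hρ 1 0
    rw [add_zero] at h
    exact (mul_eq_left₀ hρ1).mp h.symm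
  have hs0 : ∀ z : E, z ≠ 0 → sgn z ≠ 0 := by
    intro z hz h0
    obtain ⟨⟨k, hk, h⟩, -⟩ := hsgn z hz
    rw [h0, zero_pow hk.ne'] at h
    exact zero_ne_one h
  have hu0 : ∀ z : E, z ≠ 0 → uPart q ρ sgn z ≠ 0 := by
    intro z hz
    refine norm_ne_zero_iff.mp ?_
    rw [norm_eq_one_of_norm_sub_one_lt (hsgn z hz).2]
    exact one_ne_zero
  refine ⟨fun x y hx hy => ?_, fun x hx => (hsgn x hx).2, fun x hx => ?_⟩
  · have hxy : x * y ≠ 0 := mul_ne_zero hx hy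
    have hlog : rlog q (x * y) = rlog q x + rlog q y := by
      refine rlog_eq_of_norm_eq hq ?_
      rw [norm_mul, norm_eq_rpow_rlog hval hx, norm_eq_rpow_rlog hval hy, Rat.cast_add,
        Real.rpow_add (by exact_mod_cast (zero_lt_one.trans hq))]
    have hprod : uPart q ρ sgn (x * y) =
        uPart q ρ sgn x * uPart q ρ sgn y * (sgn x * sgn y * (sgn (x * y))⁻¹) := by
      have := hs0 x hx
      have := hs0 y hy
      simp only [uPart, hlog, hρ]
      field_simp
    have hux := hu0 x hx
    have huy := hu0 y hy
    have hone : sgn x * sgn y * (sgn (x * y))⁻¹ = 1 := by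
      obtain ⟨⟨k, hk, hkx⟩, hx1⟩ := hsgn x hx
      obtain ⟨⟨l, hl, hly⟩, hy1⟩ := hsgn y hy
      obtain ⟨⟨m, hm, hmxy⟩, hxy1⟩ := hsgn _ hxy
      refine eq_one_of_pow_eq_one_of_norm_sub_one_lt p (k := k * l * m) (by positivity) ?_ ?_
      · have e1 : sgn x ^ (k * l * m) = 1 := by rw [mul_assoc, pow_mul, hkx, one_pow]
        have e2 : sgn y ^ (k * l * m) = 1 := by
          rw [mul_comm k l, mul_assoc, pow_mul, hly, one_pow]
        have e3 : sgn (x * y) ^ (k * l * m) = 1 := by rw [mul_comm (k * l), pow_mul, hmxy, one_pow]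
        rw [mul_pow, mul_pow, inv_pow, e1, e2, e3, inv_one, mul_one, mul_one]
      · have h : sgn x * sgn y * (sgn (x * y))⁻¹ =
            uPart q ρ sgn (x * y) * ((uPart q ρ sgn x)⁻¹ * (uPart q ρ sgn y)⁻¹) := by
          rw [hprod]
          field_simp
        rw [h]
        have hc : max ‖uPart q ρ sgn (x * y) - 1‖
            (max ‖uPart q ρ sgn x - 1‖ ‖uPart q ρ sgn y - 1‖) < 1 :=
          max_lt hxy1 (max_lt hx1 hy1)
        refine (norm_mul_sub_one_le hc (le_max_left _ _)
          (norm_mul_sub_one_le hc ?_ ?_)).trans_lt hc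
        · rw [norm_inv_sub_one hx1]
          exact (le_max_left _ _).trans (le_max_right _ _)
        · rw [norm_inv_sub_one hy1]
          exact (le_max_right _ _).trans (le_max_right _ _)
    rw [hprod, hone, mul_one]
  · have hx1 := norm_eq_one_of_norm_sub_one_lt hx
    have hx0 : x ≠ 0 := norm_ne_zero_iff.mp (by simp [hx1])
    obtain ⟨⟨k, hk, hkx⟩, hux⟩ := hsgn x hx0
    have hlog : rlog q x = 0 := rlog_eq_of_norm_eq hq (by simp [hx1])
    have hu : uPart q ρ sgn x = x * (sgn x)⁻¹ := by rw [uPart, hlog, hρ0, mul_one]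
    have hs := hs0 x hx0
    have hone : sgn x = 1 := by
      refine eq_one_of_pow_eq_one_of_norm_sub_one_lt p hk hkx ?_
      have h : sgn x = x * (uPart q ρ sgn x)⁻¹ := by
        rw [hu]
        field_simp
      have hc := max_lt hx hux
      rw [h]
      refine (norm_mul_sub_one_le hc (le_max_left _ _) ?_).trans_lt hc
      rw [norm_inv_sub_one hux]
      exact le_max_right _ _
    rw [hu, hone, inv_one, mul_one]

end UnitPart

section Lattice

variable {F E : Type*} [Field F] [NormedField E] [Algebra F[X] E]

/-- Division by `X` in a finitely generated `F[X]`-submodule, with bounded remainder. -/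
theorem exists_norm_sub_X_smul_le {ι : Type*} [Fintype ι] (b : ι → E)
    (hC : ∀ c : F, ‖algebraMap F[X] E (C c)‖ ≤ 1) {x : E}
    (hx : x ∈ Submodule.span F[X] (Set.range b)) :
    ∃ y ∈ Submodule.span F[X] (Set.range b),
      ‖x - algebraMap F[X] E X * y‖ ≤ ∑ i, ‖b i‖ := by
  obtain ⟨c, rfl⟩ := (Submodule.mem_span_range_iff_exists_fun F[X]).mp hx
  refine ⟨∑ i, (c i).divX • b i, Submodule.sum_mem _ fun i _ =>
    Submodule.smul_mem _ _ (Submodule.subset_span ⟨i, rfl⟩), ?_⟩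
  have h : ∑ i, c i • b i - algebraMap F[X] E X * ∑ i, (c i).divX • b i =
      ∑ i, algebraMap F[X] E (C ((c i).coeff 0)) * b i := by
    rw [Finset.mul_sum, ← Finset.sum_sub_distrib]
    refine Finset.sum_congr rfl fun i _ => ?_
    rw [Algebra.smul_def, Algebra.smul_def]
    nth_rewrite 1 [← divX_mul_X_add (c i)]
    rw [map_add, map_mul]
    ring
  rw [h]
  refine (norm_sum_le _ _).trans (Finset.sum_le_sum fun i _ => ?_)
  rw [norm_mul]
  exact mul_le_of_le_one_left (norm_nonneg _) (hC _)

variable [IsUltrametricDist E]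

/-- The `1`-unit parts of the nonzero elements of a lattice are uniformly bounded away from
the unit circle around `1`. -/
theorem IsOneUnitProjection.exists_norm_sub_one_le {f : E → E} (hf : IsOneUnitProjection f)
    {Q : ℝ} (hQ : 1 < Q) (hX : ‖algebraMap F[X] E X‖ = Q)
    (hfX : f (algebraMap F[X] E X) = 1)
    (hC : ∀ c : F, ‖algebraMap F[X] E (C c)‖ ≤ 1) {ι : Type*} [Fintype ι] (b : ι → E)
    {Λ : Submodule F[X] E} (hb : Submodule.span F[X] (Set.range b) = Λ)
    (hfin : ∀ B : ℝ, {x : E | x ∈ Λ ∧ ‖x‖ ≤ B}.Finite) :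
    ∃ c < 1, ∀ x ∈ Λ, x ≠ 0 → ‖f x - 1‖ ≤ c := by
  subst hb
  set B : ℝ := ∑ i, ‖b i‖ + 1
  have hB : 0 < B := by positivity
  have hQ0 : 0 < Q := by linarith
  have hX0 : algebraMap F[X] E X ≠ 0 := norm_pos_iff.mp (by rw [hX]; exact hQ0)
  obtain ⟨c, ⟨hcF, hcQ⟩, hc1⟩ : ∃ c : ℝ,
      ((∀ x ∈ {x : E | x ∈ Submodule.span F[X] (Set.range b) ∧ ‖x‖ ≤ Q * B},
        x ≠ 0 → ‖f x - 1‖ ≤ c) ∧ Q⁻¹ ≤ c) ∧ c < 1 := by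
    have hle : ∀ a : ℝ, a < 1 → ∀ᶠ c in 𝓝[<] (1 : ℝ), a ≤ c := fun a ha =>
      (eventually_ge_nhds ha).filter_mono nhdsWithin_le_nhds
    refine Filter.Eventually.exists (f := 𝓝[<] (1 : ℝ)) (.and (.and ?_ ?_) ?_)
    · refine (eventually_all_finite (hfin _)).mpr fun x _ => ?_
      by_cases hx : x = 0
      · exact .of_forall fun c h => absurd hx h
      · filter_upwards [hle _ (hf.norm_sub_one_lt x hx)] with c hc _ using hc
    · exact hle _ (inv_lt_one_of_one_lt₀ hQ)
    · exact eventually_mem_nhdsWithin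
  refine ⟨c, hc1, ?_⟩
  suffices H : ∀ n : ℕ, ∀ x ∈ Submodule.span F[X] (Set.range b), x ≠ 0 →
      ‖x‖ ≤ Q ^ n * (Q * B) → ‖f x - 1‖ ≤ c by
    intro x hx hx0
    obtain ⟨n, hn⟩ := pow_unbounded_of_one_lt (‖x‖ / (Q * B)) hQ
    exact H n x hx hx0 ((div_lt_iff₀ (by positivity)).mp hn).le
  intro n
  induction n with
  | zero =>
    intro x hx hx0 hle
    exact hcF x ⟨hx, by simpa using hle⟩ hx0
  | succ n ih =>
    intro x hx hx0 hle
    rcases le_or_gt ‖x‖ (Q * B) with h | h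
    · exact hcF x ⟨hx, h⟩ hx0
    obtain ⟨y, hy, hxy⟩ := exists_norm_sub_X_smul_le b hC hx
    set t := algebraMap F[X] E X
    have hdB : ‖t * y - x‖ ≤ B := by
      rw [norm_sub_rev]
      exact hxy.trans (by simp [B])
    have hBx : B < ‖x‖ := by nlinarith
    have hdx : ‖t * y - x‖ < ‖x‖ := hdB.trans_lt hBx
    have hnorm : ‖t * y‖ = ‖x‖ := by
      have := IsUltrametricDist.norm_add_eq_max_of_norm_ne_norm (x := x) (y := t * y - x) hdx.ne'
      rwa [add_sub_cancel, max_eq_left hdx.le] at this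
    have hx0' : 0 < ‖x‖ := norm_pos_iff.mpr hx0
    have hy0 : y ≠ 0 := by
      rintro rfl
      rw [mul_zero, norm_zero] at hnorm
      exact hx0'.ne hnorm
    have hfy : f y = f x * (1 + (t * y - x) / x) := by
      rw [← hf.map_add hdx, add_sub_cancel, hf.map_mul _ _ hX0 hy0, hfX, one_mul]
    have hyc : ‖f y - 1‖ ≤ c := by
      refine ih y hy hy0 ?_
      rw [norm_mul, hX] at hnorm
      rw [← hnorm, pow_succ'] at hle
      rw [mul_assoc] at hle
      exact le_of_mul_le_mul_left hle hQ0
    have he : ‖(1 + (t * y - x) / x) - 1‖ ≤ c := by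
      rw [add_sub_cancel_left, norm_div]
      refine le_trans ?_ hcQ
      rw [div_le_iff₀ hx0', ← div_eq_inv_mul, le_div_iff₀ hQ0]
      nlinarith
    have hlt := he.trans_lt hc1
    have hne : 1 + (t * y - x) / x ≠ 0 := norm_ne_zero_iff.mp (by
      rw [norm_eq_one_of_norm_sub_one_lt hlt]
      exact one_ne_zero)
    rw [← mul_inv_cancel_right₀ hne (f x), ← hfy]
    exact norm_mul_sub_one_le hc1 hyc ((norm_inv_sub_one hlt).le.trans he)

end Lattice

section Cosets

variable {E : Type*} [NormedField E] [IsUltrametricDist E]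

/-- The product of the `1`-unit parts over a coset `x + V` of a finite group `V` is close to `1`
when `V` is large and its elements are small compared to `x`. -/
theorem IsOneUnitProjection.norm_prod_coset_sub_one_le (p : ℕ) [Fact p.Prime] [CharP E p]
    {f : E → E} (hf : IsOneUnitProjection f) (V : AddSubgroup E) [Fintype V] {c ε : ℝ}
    (hε : ε < 1) (hε0 : 0 ≤ ε) (hcV : c ^ Nat.card V ≤ ε) {x : E} (hx : x ≠ 0)
    (hxc : ‖f x - 1‖ ≤ c) (hV : ∀ v ∈ V, ‖v‖ ≤ ε * ‖x‖) :
    ‖∏ v : V, f (x + v) - 1‖ ≤ ε := by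
  have hx0 : 0 < ‖x‖ := norm_pos_iff.mpr hx
  have hterm : ∀ v : V, f (x + v) = f x * (1 + v / x) := fun v =>
    hf.map_add ((hV v v.2).trans_lt (by nlinarith))
  simp_rw [hterm]
  rw [Finset.prod_mul_distrib, Finset.prod_const, Finset.card_univ, ← Nat.card_eq_fintype_card]
  refine norm_mul_sub_one_le hε ?_ (norm_prod_sub_one_le hε0 hε _ _ fun v _ => ?_)
  · have hpV : IsPGroup p (Multiplicative V) := fun v => ⟨1, by
      rw [pow_one]
      refine Multiplicative.toAdd.injective (Subtype.ext ?_)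
      simp [toAdd_pow]⟩
    obtain ⟨n, hn⟩ := IsPGroup.iff_card.mp hpV
    rw [Nat.card_congr Multiplicative.toAdd] at hn
    rw [hn] at hcV ⊢
    have h := sub_pow_char_pow (p := p) (n := n) (f x) 1
    rw [one_pow] at h
    rw [← h, norm_pow]
    exact (pow_le_pow_left₀ (norm_nonneg _) hxc _).trans hcV
  · rw [add_sub_cancel_left, norm_div, div_le_iff₀ hx0]
    exact hV v v.2

/-- A product over a finite union of cosets of `V` is close to `1` if this holds for
each coset. -/
theorem norm_prod_sub_one_le_of_add_invariant (V : AddSubgroup E) [Fintype V] (f : E → E)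
    {ε : ℝ} (hε0 : 0 ≤ ε) (hε : ε < 1) (s : Finset E) (hs : ∀ x ∈ s, ∀ v ∈ V, x + v ∈ s)
    (hf : ∀ x ∈ s, ‖∏ v : V, f (x + v) - 1‖ ≤ ε) : ‖∏ x ∈ s, f x - 1‖ ≤ ε := by
  rw [← Finset.prod_fiberwise_of_maps_to
    (t := s.image (QuotientAddGroup.mk : E → E ⧸ V)) (g := QuotientAddGroup.mk)
    fun x hx => Finset.mem_image_of_mem _ hx]
  refine norm_prod_sub_one_le hε0 hε _ _ fun y hy => ?_
  obtain ⟨x, hx, rfl⟩ := Finset.mem_image.mp hy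
  convert hf x hx using 3
  symm
  refine Finset.prod_bij (fun v _ => x + v) (fun v _ => ?_) (fun v _ w _ h => ?_)
    (fun z hz => ?_) (fun v _ => rfl)
  · refine Finset.mem_filter.mpr ⟨hs x hx v v.2, ?_⟩
    simp
  · exact Subtype.ext (add_left_cancel h)
  · obtain ⟨hz1, hz2⟩ := Finset.mem_filter.mp hz
    exact ⟨⟨-x + z, QuotientAddGroup.eq.mp hz2.symm⟩, Finset.mem_univ _, by simp⟩

theorem IsOneUnitProjection.exists_norm_prod_sub_one_le (p : ℕ) [Fact p.Prime] [CharP E p]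
    {f : E → E} (hf : IsOneUnitProjection f) (Λ : AddSubgroup E)
    (hfin : ∀ B : ℝ, {x : E | x ∈ Λ ∧ ‖x‖ ≤ B}.Finite) (u : E) {c : ℝ} (hc0 : 0 ≤ c)
    (hc : c < 1) (huc : ∀ x : E, x - u ∈ Λ → x ≠ 0 → ‖f x - 1‖ ≤ c) {ε : ℝ} (hε0 : 0 < ε)
    (hε : ε < 1) :
    ∃ R₀ : ℝ, ∀ R₁ R₂ : ℝ, R₀ ≤ R₁ → ∀ s : Finset E,
      (∀ x, x ∈ s ↔ x - u ∈ Λ ∧ R₁ < ‖x‖ ∧ ‖x‖ ≤ R₂) → ‖∏ x ∈ s, f x - 1‖ ≤ ε := by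
  by_cases hΛ : (Λ : Set E).Finite
  · obtain ⟨R, hR⟩ := (hΛ.image fun x => ‖x + u‖).bddAbove
    refine ⟨R, fun R₁ R₂ h s hs => ?_⟩
    have hempty : s = ∅ := by
      refine Finset.eq_empty_of_forall_notMem fun x hx => ?_
      obtain ⟨h1, h2, -⟩ := (hs x).mp hx
      have h3 : ‖x - u + u‖ ≤ R := hR ⟨x - u, h1, rfl⟩
      rw [sub_add_cancel] at h3
      linarith
    simp [hempty, hε0.le]
  obtain ⟨m, hm⟩ := exists_pow_lt_of_lt_one hε0 hc
  obtain ⟨t, htΛ, htm⟩ := Set.Infinite.exists_subset_card_eq hΛ m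
  obtain ⟨R, hR⟩ := (t.finite_toSet.image fun x : E => ‖x‖).bddAbove
  set B : ℝ := max R 0
  let V : AddSubgroup E :=
    { carrier := {x : E | x ∈ Λ ∧ ‖x‖ ≤ B}
      zero_mem' := ⟨Λ.zero_mem, by simp [B]⟩
      add_mem' := fun ha hb => ⟨Λ.add_mem ha.1 hb.1,
        (IsUltrametricDist.norm_add_le_max _ _).trans (max_le ha.2 hb.2)⟩
      neg_mem' := fun ha => ⟨Λ.neg_mem ha.1, by rw [norm_neg]; exact ha.2⟩ }
  have hVfin : (V : Set E).Finite := hfin B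
  let _ : Fintype V := hVfin.fintype
  have hcard : m ≤ Nat.card V := by
    have h : (t : Set E) ⊆ V := fun x hx =>
      ⟨htΛ hx, (hR ⟨x, hx, rfl⟩).trans (le_max_left _ _)⟩
    have h' := Set.ncard_le_ncard h hVfin
    rwa [Set.ncard_coe_finset, htm] at h'
  have hcV : c ^ Nat.card V ≤ ε := (pow_le_pow_of_le_one hc0 hc.le hcard).trans hm.le
  refine ⟨B / ε, fun R₁ R₂ hR₁ s hs => ?_⟩
  have hsmall : ∀ x ∈ s, ∀ v ∈ V, ‖v‖ ≤ ε * ‖x‖ := by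
    intro x hx v hv
    have h := (div_le_iff₀' hε0).mp (hR₁.trans ((hs x).mp hx).2.1.le)
    exact hv.2.trans h
  have hne : ∀ x ∈ s, 0 < ‖x‖ := fun x hx =>
    (div_nonneg (le_max_right R 0) hε0.le).trans_lt (hR₁.trans_lt ((hs x).mp hx).2.1)
  refine norm_prod_sub_one_le_of_add_invariant V f hε0.le hε s (fun x hx v hv => ?_)
    fun x hx => ?_
  · have hlt : ‖v‖ < ‖x‖ := (hsmall x hx v hv).trans_lt (by nlinarith [hne x hx])
    have hnorm : ‖x + v‖ = ‖x‖ := by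
      rw [IsUltrametricDist.norm_add_eq_max_of_norm_ne_norm hlt.ne', max_eq_left hlt.le]
    obtain ⟨h1, h2⟩ := (hs x).mp hx
    refine (hs _).mpr ⟨?_, by rwa [hnorm]⟩
    rw [add_sub_right_comm]
    exact Λ.add_mem h1 hv.1
  · have hx0 := norm_pos_iff.mp (hne x hx)
    exact hf.norm_prod_coset_sub_one_le p V hε hε0.le hcV hx0
      (huc x ((hs x).mp hx).1 hx0) (hsmall x hx)

end Cosets

/-- A family of `1`-units which is multiplicatively Cauchy converges to a `1`-unit. -/
theorem exists_tendsto_of_norm_mul_sub_one_le {E : Type*} [NormedField E] [IsUltrametricDist E]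
    [CompleteSpace E] (P : ℚ → E) (h1 : ∀ N, ‖P N - 1‖ < 1)
    (hP : ∀ ε : ℝ, 0 < ε → ε < 1 → ∃ N₀, ∀ N ≥ N₀, ∃ g : E, P N = P N₀ * g ∧ ‖g - 1‖ ≤ ε) :
    ∃ U : E, U ≠ 0 ∧ ‖U - 1‖ < 1 ∧ Tendsto P atTop (𝓝 U) := by
  have hdist : ∀ ε : ℝ, 0 < ε → ε < 1 → ∃ N₀, ∀ N ≥ N₀, ‖P N - P N₀‖ ≤ ε := by
    intro ε hε0 hε
    obtain ⟨N₀, h⟩ := hP ε hε0 hε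
    refine ⟨N₀, fun N hN => ?_⟩
    obtain ⟨g, hg, hg1⟩ := h N hN
    have : P N - P N₀ = P N₀ * (g - 1) := by rw [hg]; ring
    rw [this, norm_mul, norm_eq_one_of_norm_sub_one_lt (h1 N₀), one_mul]
    exact hg1
  have hcauchy : CauchySeq P := by
    refine Metric.cauchySeq_iff'.mpr fun ε hε => ?_
    obtain ⟨N₀, h⟩ := hdist (min (ε / 2) (1 / 2)) (by positivity)
      ((min_le_right _ _).trans_lt (by norm_num))
    refine ⟨N₀, fun N hN => ?_⟩
    rw [dist_eq_norm]
    exact ((h N hN).trans (min_le_left _ _)).trans_lt (by linarith)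
  obtain ⟨U, hU⟩ := cauchySeq_tendsto_of_complete hcauchy
  have hU1 : ‖U - 1‖ < 1 := by
    obtain ⟨N₀, h⟩ := hdist (1 / 2) (by norm_num) (by norm_num)
    have hle : ‖U - P N₀‖ ≤ 1 / 2 :=
      le_of_tendsto (hU.sub_const (P N₀)).norm (eventually_atTop.mpr ⟨N₀, h⟩)
    rw [← sub_add_sub_cancel U (P N₀) 1]
    exact (IsUltrametricDist.norm_add_le_max _ _).trans_lt
      (max_lt (hle.trans_lt (by norm_num)) (h1 N₀))
  refine ⟨U, norm_ne_zero_iff.mp ?_, hU1, hU⟩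
  rw [norm_eq_one_of_norm_sub_one_lt hU1]
  exact one_ne_zero

section BallSet

variable {F E : Type*} [Field F] [NormedField E] [Algebra F[X] E]

theorem mem_ballSet_iff {q : ℕ} (hq : 1 < q) {Λ : Submodule F[X] E} {u : E} {N : ℚ} {x : E} :
    x ∈ ballSet q Λ u N ↔ x ≠ 0 ∧ x - u ∈ Λ ∧ ‖x‖ ≤ (q : ℝ) ^ (N : ℝ) := by
  refine and_congr_right fun hx => and_congr_right fun _ => ?_
  exact Real.logb_le_iff_le_rpow (by exact_mod_cast hq) (norm_pos_iff.mpr hx)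

theorem ballSet_congr (q : ℕ) {Λ : Submodule F[X] E} {u u' : E} (h : u - u' ∈ Λ) (N : ℚ) :
    ballSet q Λ u' N = ballSet q Λ u N := by
  ext x
  refine and_congr_right fun _ => and_congr_left fun _ => ?_
  rw [← sub_add_sub_cancel x u u']
  exact Submodule.add_mem_iff_left Λ h

theorem ballSet_finite {q : ℕ} (hq : 1 < q) {Λ : Submodule F[X] E}
    (hfin : ∀ B : ℝ, {x : E | x ∈ Λ ∧ ‖x‖ ≤ B}.Finite) (u : E) (N : ℚ) :
    (ballSet q Λ u N).Finite := by
  refine ((hfin ((q : ℝ) ^ (N : ℝ) + ‖u‖)).image (· + u)).subset fun x hx => ?_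
  obtain ⟨-, h1, h2⟩ := (mem_ballSet_iff hq).mp hx
  exact ⟨x - u, ⟨h1, (norm_sub_le x u).trans (by gcongr)⟩, sub_add_cancel x u⟩

end BallSet

/-- The finite products `∏_{0≠λ∈u+Λ, log λ ≤ N} ⟨λ⟩` converge, as the
rational number `N → ∞`, to a limit `U_{u,Λ} ∈ L^×` which is a `1`-unit and depends only
on the class of `u` modulo `Λ`. -/
theorem statement10
    (q : ℕ) (hq : Fintype.card Fq = q)
    (hna : ∀ x y : L, ‖x + y‖ ≤ max ‖x‖ ‖y‖)
    (hA : ∀ a : Polynomial Fq, a ≠ 0 →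
      ‖algebraMap (Polynomial Fq) L a‖ = (q : ℝ) ^ a.natDegree)
    (hval : ∀ x : L, x ≠ 0 → ∃ s : ℚ, ‖x‖ = (q : ℝ) ^ (s : ℝ))
    (ρ : ℚ → L) (sgn : L → L)
    (hρ : ∀ x y : ℚ, ρ (x + y) = ρ x * ρ y)
    (hρ1 : ρ 1 * algebraMap (Polynomial Fq) L Polynomial.X = 1)
    (hsgn : ∀ z : L, z ≠ 0 →
      (∃ k : ℕ, 0 < k ∧ sgn z ^ k = 1) ∧ ‖uPart q ρ sgn z - 1‖ < 1)
    (r : ℕ)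
    (Λ : Submodule (Polynomial Fq) L) (hΛ : IsLatticeOfRank r Λ)
    (u : L) (hu : InKSpan Λ u) :
    ∃ U : L, U ≠ 0 ∧ ‖U - 1‖ < 1 ∧
      Filter.Tendsto (fun N : ℚ => ∏ᶠ l ∈ ballSet q Λ u N, uPart q ρ sgn l)
        Filter.atTop (nhds U) ∧
      ∀ u' : L, u - u' ∈ Λ →
        Filter.Tendsto (fun N : ℚ => ∏ᶠ l ∈ ballSet q Λ u' N, uPart q ρ sgn l)
          Filter.atTop (nhds U) := by
  have : IsUltrametricDist L :=
    IsUltrametricDist.isUltrametricDist_of_forall_norm_add_le_max_norm hna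
  have hq1 : 1 < q := hq ▸ Fintype.one_lt_card
  have hq1' : (1 : ℝ) < q := by exact_mod_cast hq1
  have hinj : ∀ a : Polynomial Fq, a ≠ 0 → algebraMap (Polynomial Fq) L a ≠ 0 := fun a ha =>
    norm_ne_zero_iff.mp (by rw [hA a ha]; positivity)
  obtain ⟨p, hp⟩ := CharP.exists Fq
  have : Fact p.Prime := ⟨CharP.char_is_prime Fq p⟩
  have : CharP L p :=
    charP_of_injective_ringHom ((algebraMap (Polynomial Fq) L).comp Polynomial.C).injective p
  have hX : ‖algebraMap (Polynomial Fq) L Polynomial.X‖ = q := by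
    rw [hA _ Polynomial.X_ne_zero, Polynomial.natDegree_X, pow_one]
  have hC : ∀ c : Fq, ‖algebraMap (Polynomial Fq) L (Polynomial.C c)‖ ≤ 1 := by
    intro c
    by_cases hc : c = 0
    · simp [hc]
    · rw [hA _ (Polynomial.C_ne_zero.mpr hc), Polynomial.natDegree_C, pow_zero]
  have hf := isOneUnitProjection_uPart p hq1 hval hρ (left_ne_zero_of_mul_eq_one hρ1) hsgn
  have hfX := uPart_eq_one_of_mul_eq_one p hq1 hX hρ1 hsgn
  obtain ⟨⟨b, -, hb⟩, hfin⟩ := hΛ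
  obtain ⟨c, hc1, hc⟩ := hf.exists_norm_sub_one_le hq1' hX hfX hC b hb hfin
  obtain ⟨n, hn0, hnu⟩ := hu
  set a := algebraMap (Polynomial Fq) L n
  have ha : a ≠ 0 := hinj n hn0
  set f := uPart q ρ sgn
  have ha1 := hf.norm_sub_one_lt a ha
  have hd1 : max c ‖f a - 1‖ < 1 := max_lt hc1 ha1
  have hd : ∀ x : L, x - u ∈ Λ → x ≠ 0 → ‖f x - 1‖ ≤ max c ‖f a - 1‖ := by
    intro x hx hx0
    have hmem : a * x ∈ Λ := by
      have h := Λ.add_mem (Λ.smul_mem n hx) hnu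
      rwa [← smul_add, sub_add_cancel, Algebra.smul_def] at h
    have hfa : f a ≠ 0 := norm_ne_zero_iff.mp (by
      rw [norm_eq_one_of_norm_sub_one_lt ha1]
      exact one_ne_zero)
    rw [← inv_mul_cancel_left₀ hfa (f x), ← hf.map_mul a x ha hx0]
    exact norm_mul_sub_one_le hd1 ((norm_inv_sub_one ha1).le.trans (le_max_right _ _))
      ((hc _ hmem (mul_ne_zero ha hx0)).trans (le_max_left _ _))
  have hd0 : 0 ≤ max c ‖f a - 1‖ := (norm_nonneg _).trans (le_max_right _ _)
  have hballs := ballSet_finite hq1 hfin u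
  obtain ⟨U, hU0, hU1, hU⟩ := exists_tendsto_of_norm_mul_sub_one_le
    (fun N : ℚ => ∏ᶠ l ∈ ballSet q Λ u N, f l)
    (fun N => by
      refine lt_of_le_of_lt ?_ hd1
      rw [finprod_mem_eq_finite_toFinset_prod _ (hballs N)]
      refine norm_prod_sub_one_le hd0 hd1 _ _ fun x hx => ?_
      rw [Set.Finite.mem_toFinset] at hx
      exact hd x hx.2.1 hx.1)
    (fun ε hε0 hε => by
      obtain ⟨R₀, hR₀⟩ := hf.exists_norm_prod_sub_one_le p Λ.toAddSubgroup hfin u hd0 hd1 hd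
        hε0 hε
      obtain ⟨k, hk⟩ := pow_unbounded_of_one_lt R₀ hq1'
      refine ⟨k, fun N hN => ⟨∏ᶠ l ∈ ballSet q Λ u N \ ballSet q Λ u k, f l, ?_, ?_⟩⟩
      · have hsub : ballSet q Λ u k ⊆ ballSet q Λ u N := fun x hx =>
          ⟨hx.1, hx.2.1, hx.2.2.trans (by exact_mod_cast hN)⟩
        exact (finprod_mem_mul_sdiff hsub (hballs N)).symm
      · rw [finprod_mem_eq_finite_toFinset_prod _ ((hballs N).sdiff)]
        refine hR₀ ((q : ℝ) ^ k) ((q : ℝ) ^ (N : ℝ)) hk.le _ fun x => ?_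
        rw [Set.Finite.mem_toFinset, Set.mem_sdiff, mem_ballSet_iff hq1, mem_ballSet_iff hq1,
          Rat.cast_natCast, Real.rpow_natCast]
        constructor
        · rintro ⟨⟨h0, h1, h2⟩, h3⟩
          exact ⟨h1, lt_of_not_ge fun h => h3 ⟨h0, h1, h⟩, h2⟩
        · rintro ⟨h1, h2, h3⟩
          have h0 : x ≠ 0 := norm_pos_iff.mp (lt_trans (by positivity) h2)
          exact ⟨⟨h0, h1, h3⟩, fun h => h2.not_ge h.2.2⟩)
  refine ⟨U, hU0, hU1, hU, fun u' hu' => ?_⟩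
  simpa only [ballSet_congr q hu'] using hU
end
end
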